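/- (Determinant factorization for words omitting σ_{n−1}; Case 2 of Theorem 1.) Let n ≥ 3 and let i_1, …, i_r be any finite sequence with each i_k ∈ {1, …, n−2}. Then det( M_n(σ_{i_1}) ⋯ M_n(σ_{i_r}) − I_m ) = det( A − I_{n−1} ) · det( M_{n−1}(σ_{i_1}) ⋯ M_{n−1}(σ_{i_r}) − I_{m′} ), where m′ = (n−1)(n−2)/2 and A is the product, in the same order, of the (n−1)×(n−1) matrices induced by each M_n(σ_{i_k}) on the quotient by the span of {e_{i,j} : j ≤ n−1} (each such induced matrix equals α_{i_k} up to the convention for the matrix of a linear map). In particular this determinant is zero. -/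

import Mathlib

noncomputable section

open Matrix

/-- The Laurent polynomial ring `ℤ[q^{±1}, t^{±1}]`, realized as iterated
Laurent polynomials over `ℤ`. -/
abbrev KR : Type := LaurentPolynomial (LaurentPolynomial ℤ)

/-- The variable `q` of `ℤ[q^{±1}, t^{±1}]`. -/
noncomputable def qv : KR := LaurentPolynomial.C (LaurentPolynomial.T 1)

/-- The variable `t` of `ℤ[q^{±1}, t^{±1}]`. -/
noncomputable def tv : KR := LaurentPolynomial.T 1

/-- The coefficient of `e_{i',j'}` in `K(σ_k)(e_{i,j})`, with 1-based indices,
over any commutative ring with chosen elements `q`, `t`. -/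
def krammerEntry {A : Type*} [CommRing A] (q t : A) (k i j i' j' : ℕ) : A :=
  if i = k ∧ j = k + 1 then
    (if i' = k ∧ j' = k + 1 then t * q ^ 2 else 0)
  else if j = k ∧ i < k then
    (if i' = i ∧ j' = k then 1 - q else if i' = i ∧ j' = k + 1 then q else 0)
  else if j = k + 1 ∧ i < k then
    (if i' = i ∧ j' = k then 1
     else if i' = k ∧ j' = k + 1 then t * q ^ (k - i + 1) * (q - 1) else 0)
  else if i = k ∧ k + 1 < j then
    (if i' = k ∧ j' = k + 1 then t * q * (q - 1)
     else if i' = k + 1 ∧ j' = j then q else 0)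
  else if i = k + 1 ∧ k + 1 < j then
    (if i' = k ∧ j' = j then 1 else if i' = k + 1 ∧ j' = j then 1 - q else 0)
  else if i < k ∧ k + 1 < j then
    (if i' = i ∧ j' = j then 1
     else if i' = k ∧ j' = k + 1 then t * q ^ (k - i) * (q - 1) ^ 2 else 0)
  else (if i' = i ∧ j' = j then 1 else 0)

/-- The index set of pairs `(i,j)` with `1 ≤ i < j ≤ n` (realized 0-based). -/
abbrev KIdx (n : ℕ) : Type := {p : Fin n × Fin n // p.1 < p.2}

/-- First (1-based) component `i` of an index pair. -/
def idx1 {n : ℕ} (a : KIdx n) : ℕ := a.val.1.val + 1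

/-- Second (1-based) component `j` of an index pair. -/
def idx2 {n : ℕ} (a : KIdx n) : ℕ := a.val.2.val + 1

/-- The Krammer matrix `M_n(σ_k)` over any commutative ring with chosen `q`, `t`:
the row indexed by `(i,j)` gives the image `K(σ_k)(e_{i,j})`. -/
def krammerMatrix {A : Type*} [CommRing A] (q t : A) (n k : ℕ) :
    Matrix (KIdx n) (KIdx n) A :=
  fun a b => krammerEntry q t k (idx1 a) (idx2 a) (idx1 b) (idx2 b)

/-- The Krammer matrix `M_n(σ_k)` over `ℤ[q^{±1}, t^{±1}]`. -/
noncomputable def M (n k : ℕ) : Matrix (KIdx n) (KIdx n) KR := krammerMatrix qv tv n k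

/-- For `1 ≤ i ≤ n−2`, the `(n−1)×(n−1)` matrix
`α_i = I_{i−1} ⊕ [[0, q],[1, 1−q]] ⊕ I_{n−i−2}`: the identity except in rows and
columns `i` and `i+1` (1-based), where it carries the block `[[0, q],[1, 1−q]]`. -/
def alpha {A : Type*} [CommRing A] (q : A) (n i : ℕ) :
    Matrix (Fin (n - 1)) (Fin (n - 1)) A :=
  fun a b =>
    if a.val + 1 = i ∧ b.val + 1 = i then 0
    else if a.val + 1 = i ∧ b.val + 1 = i + 1 then q
    else if a.val + 1 = i + 1 ∧ b.val + 1 = i then 1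
    else if a.val + 1 = i + 1 ∧ b.val + 1 = i + 1 then 1 - q
    else if a = b then 1 else 0

/-- Splitting the pairs `i < j` in `{0, …, N}` according to whether `j < N` or `j = N`. -/
def kIdxSuccEquiv (N : ℕ) : KIdx (N + 1) ≃ KIdx N ⊕ Fin N where
  toFun a :=
    if h : a.val.2.val < N then
      Sum.inl ⟨(⟨a.val.1.val, lt_trans a.property h⟩, ⟨a.val.2.val, h⟩), a.property⟩
    else Sum.inr ⟨a.val.1.val, by have := a.property; have := a.val.2.isLt; omega⟩
  invFun := Sum.elim
    (fun p => ⟨(p.val.1.castSucc, p.val.2.castSucc), p.property⟩)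
    (fun i => ⟨(i.castSucc, Fin.last N), i.isLt⟩)
  left_inv := by
    rintro ⟨⟨⟨i, hi⟩, ⟨j, hj⟩⟩, hij⟩
    by_cases h : j < N
    · simp [h]
    · have : j = N := by omega
      simp [this, Fin.last]
  right_inv := by
    rintro (⟨⟨i, j⟩, hij⟩ | i) <;> simp

lemma idx1_kIdxSuccEquiv_symm_inl {N : ℕ} (p : KIdx N) :
    idx1 ((kIdxSuccEquiv N).symm (Sum.inl p)) = idx1 p := rfl

lemma idx2_kIdxSuccEquiv_symm_inl {N : ℕ} (p : KIdx N) :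
    idx2 ((kIdxSuccEquiv N).symm (Sum.inl p)) = idx2 p := rfl

lemma idx1_kIdxSuccEquiv_symm_inr {N : ℕ} (i : Fin N) :
    idx1 ((kIdxSuccEquiv N).symm (Sum.inr i)) = i.val + 1 := rfl

lemma idx2_kIdxSuccEquiv_symm_inr {N : ℕ} (i : Fin N) :
    idx2 ((kIdxSuccEquiv N).symm (Sum.inr i)) = N + 1 := rfl

/-- If `k + 1` is below the last strand, the Krammer matrix is block lower triangular with
diagonal blocks the smaller Krammer matrix and `alpha`. -/
lemma krammerMatrix_reindex_kIdxSuccEquiv {A : Type*} [CommRing A] (q t : A) {N k : ℕ}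
    (hk : k + 1 ≤ N) :
    ∃ B, Matrix.reindex (kIdxSuccEquiv N) (kIdxSuccEquiv N) (krammerMatrix q t (N + 1) k) =
      fromBlocks (krammerMatrix q t N k) 0 B (alpha q (N + 1) k) := by
  refine ⟨(Matrix.reindex (kIdxSuccEquiv N) (kIdxSuccEquiv N)
    (krammerMatrix q t (N + 1) k)).toBlocks₂₁, ?_⟩
  ext (a | a) (b | b)
  · rfl
  · have ha : idx2 a ≤ N := a.val.2.isLt
    simp only [reindex_apply, submatrix_apply, fromBlocks_apply₁₂, Matrix.zero_apply,
      krammerMatrix, krammerEntry, idx1_kIdxSuccEquiv_symm_inl, idx2_kIdxSuccEquiv_symm_inl,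
      idx1_kIdxSuccEquiv_symm_inr, idx2_kIdxSuccEquiv_symm_inr]
    grind (splits := 20)
  · rfl
  · simp only [reindex_apply, submatrix_apply, fromBlocks_apply₂₂,
      krammerMatrix, krammerEntry, alpha, Fin.ext_iff,
      idx1_kIdxSuccEquiv_symm_inr, idx2_kIdxSuccEquiv_symm_inr]
    grind (splits := 20)

lemma krammerMatrix_list_prod_reindex {A : Type*} [CommRing A] (q t : A) (N : ℕ) (l : List ℕ)
    (hl : ∀ k ∈ l, k + 1 ≤ N) :
    ∃ B, Matrix.reindex (kIdxSuccEquiv N) (kIdxSuccEquiv N)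
        (l.map (krammerMatrix q t (N + 1))).prod =
      fromBlocks (l.map (krammerMatrix q t N)).prod 0 B (l.map (alpha q (N + 1))).prod := by
  induction l with
  | nil => exact ⟨0, by simp⟩
  | cons k l ih =>
    obtain ⟨B, hB⟩ := krammerMatrix_reindex_kIdxSuccEquiv q t (hl k (by simp))
    obtain ⟨C, hC⟩ := ih fun j hj => hl j (by simp [hj])
    simp only [List.map_cons, List.prod_cons]
    rw [← Matrix.coe_reindexAlgEquiv ℤ A, map_mul, Matrix.coe_reindexAlgEquiv, hB, hC,
      fromBlocks_multiply]
    exact ⟨_, by simp only [Matrix.zero_mul, Matrix.mul_zero, add_zero, zero_add]; rfl⟩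

lemma det_krammerMatrix_list_prod_sub_one {A : Type*} [CommRing A] (q t : A) (N : ℕ)
    (l : List ℕ) (hl : ∀ k ∈ l, k + 1 ≤ N) :
    ((l.map (krammerMatrix q t (N + 1))).prod - 1).det =
      ((l.map (alpha q (N + 1))).prod - 1).det * ((l.map (krammerMatrix q t N)).prod - 1).det := by
  obtain ⟨B, hB⟩ := krammerMatrix_list_prod_reindex q t N l hl
  rw [← Matrix.det_reindex_self (kIdxSuccEquiv N), ← Matrix.coe_reindexAlgEquiv ℤ A, map_sub,
    map_one, Matrix.coe_reindexAlgEquiv, hB, ← fromBlocks_one, sub_eq_add_neg, fromBlocks_neg,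
    fromBlocks_add, neg_zero, add_zero, det_fromBlocks_zero₁₂, mul_comm, ← sub_eq_add_neg,
    ← sub_eq_add_neg]

/-- The columns of `alpha q n i` sum to `1`. -/
lemma one_vecMul_alpha {A : Type*} [CommRing A] (q : A) {n i : ℕ} (hi : 1 ≤ i)
    (hin : i + 1 ≤ n - 1) : 1 ᵥ* alpha q n i = 1 := by
  ext b
  simp only [vecMul, dotProduct, Pi.one_apply, one_mul]
  have h (a : Fin (n - 1)) : alpha q n i a b =
      if b.val + 1 = i then (if a = ⟨i, hin⟩ then 1 else 0)
      else if b.val = i then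
        (if a = ⟨i - 1, by omega⟩ then q else 0) + (if a = b then 1 - q else 0)
      else if a = b then 1 else 0 := by
    simp only [alpha, Fin.ext_iff]
    grind
  simp only [h]
  split_ifs <;> simp [Finset.sum_add_distrib]

lemma det_alpha_list_prod_sub_one {A : Type*} [CommRing A] [IsDomain A] (q : A) {n : ℕ}
    (hn : 2 ≤ n) (l : List ℕ) (hl : ∀ i ∈ l, 1 ≤ i ∧ i + 1 ≤ n - 1) :
    ((l.map (alpha q n)).prod - 1).det = 0 := by
  have hfix : 1 ᵥ* (l.map (alpha q n)).prod = 1 := by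
    induction l with
    | nil => simp
    | cons i l ih =>
      rw [List.map_cons, List.prod_cons, ← vecMul_vecMul,
        one_vecMul_alpha q (hl i (by simp)).1 (hl i (by simp)).2]
      exact ih fun j hj => hl j (by simp [hj])
  refine exists_vecMul_eq_zero_iff.mp ⟨1, fun h => ?_, ?_⟩
  · exact one_ne_zero (congrFun h ⟨0, by omega⟩)
  · rw [vecMul_sub, hfix, vecMul_one, sub_self]

/-- Case 2 of Theorem 1: for a word in the generators
`σ_{i_1}, …, σ_{i_r}` with each `i_k ∈ {1,…,n−2}` (omitting `σ_{n−1}`),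
`det(M_n(σ_{i_1})⋯M_n(σ_{i_r}) − I_m)` factors as
`det(A − I_{n−1})·det(M_{n−1}(σ_{i_1})⋯M_{n−1}(σ_{i_r}) − I_{m'})`, where
`A = α_{i_1}⋯α_{i_r}` is the product of the matrices induced on the quotient by
the span of `{e_{i,j} : j ≤ n−1}`; in particular the determinant is zero. -/
theorem krammer_det_factorization_omit_sigma_last (n : ℕ) (hn : 3 ≤ n)
    (l : List ℕ) (hl : ∀ i ∈ l, 1 ≤ i ∧ i ≤ n - 2) :
    ((l.map (M n)).prod - 1).det =
      ((l.map (alpha qv n)).prod - 1).det *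
        ((l.map (M (n - 1))).prod - 1).det ∧
    ((l.map (M n)).prod - 1).det = 0 := by
  obtain ⟨N, rfl⟩ : ∃ N, n = N + 1 := ⟨n - 1, by omega⟩
  have hdet := det_krammerMatrix_list_prod_sub_one qv tv N l fun k hk => by
    have := hl k hk
    omega
  refine ⟨hdet, hdet.trans ?_⟩
  rw [det_alpha_list_prod_sub_one qv (by omega) l fun k hk => ?_, zero_mul]
  have := hl k hk
  omega
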